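/- arXiv:2501.04044 — 2 statements merged into one kernel-verified Lean document; each statement's English description precedes it below -/
import Mathlib

section
/- For any finite list of vectors v₁, …, v_k ∈ ℝ^n and any vector x ∈ ℝ^n, the trace over the exterior algebra Λ*V of the product c(v₁)∘c(v₂)∘⋯∘c(v_k)∘ĉ(x) is zero. -/
noncomputable section

open scoped BigOperators

/-- `V n` is `ℝⁿ` with its standard inner product. -/
abbrev V (n : ℕ) := EuclideanSpace ℝ (Fin n)

/-- Left exterior multiplication `ε(v)` on the exterior algebra `Λ*V`. -/
noncomputable def eps {n : ℕ} (v : V n) :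
    Module.End ℝ (ExteriorAlgebra ℝ (V n)) :=
  LinearMap.mulLeft ℝ (ExteriorAlgebra.ι ℝ v)

/-- Interior multiplication (contraction) `ι(v)` on the exterior algebra `Λ*V`,
the contraction determined by the standard inner product. -/
noncomputable def iotaOp {n : ℕ} (v : V n) :
    Module.End ℝ (ExteriorAlgebra ℝ (V n)) :=
  CliffordAlgebra.contractLeft (Q := (0 : QuadraticForm ℝ (V n)))
    ((innerSL ℝ v).toLinearMap)

/-- The Clifford operator `c(v) = ε(v) - ι(v)`. -/
noncomputable def cOp {n : ℕ} (v : V n) :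
    Module.End ℝ (ExteriorAlgebra ℝ (V n)) :=
  eps v - iotaOp v

/-- The Clifford operator `ĉ(v) = ε(v) + ι(v)`. -/
noncomputable def cHat {n : ℕ} (v : V n) :
    Module.End ℝ (ExteriorAlgebra ℝ (V n)) :=
  eps v + iotaOp v

/-- The standard orthonormal basis vector `e_f` of `ℝⁿ`. -/
noncomputable def stdBasis {n : ℕ} (f : Fin n) : V n :=
  EuclideanSpace.single f (1 : ℝ)

theorem iotaOp_ι_mul {n : ℕ} (v w : V n) (a : ExteriorAlgebra ℝ (V n)) :
    iotaOp v (ExteriorAlgebra.ι ℝ w * a) =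
      inner ℝ v w • a - ExteriorAlgebra.ι ℝ w * iotaOp v a :=
  CliffordAlgebra.contractLeft_ι_mul (Q := (0 : QuadraticForm ℝ (V n))) _ _ _

theorem iotaOp_anticomm {n : ℕ} (v w : V n) (a : ExteriorAlgebra ℝ (V n)) :
    iotaOp v (iotaOp w a) = -iotaOp w (iotaOp v a) :=
  CliffordAlgebra.contractLeft_comm _ _ _

theorem cOp_mul_cHat {n : ℕ} (v x : V n) : cOp v * cHat x = -(cHat x * cOp v) := by
  refine LinearMap.ext fun a => ?_
  have h : ExteriorAlgebra.ι ℝ v * (ExteriorAlgebra.ι ℝ x * a) +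
      ExteriorAlgebra.ι ℝ x * (ExteriorAlgebra.ι ℝ v * a) = 0 := by
    rw [← mul_assoc, ← mul_assoc, ← add_mul, ExteriorAlgebra.ι_add_mul_swap, zero_mul]
  simp only [cOp, cHat, eps, Module.End.mul_apply, LinearMap.neg_apply, LinearMap.add_apply,
    LinearMap.sub_apply, LinearMap.mulLeft_apply, mul_add, mul_sub,
    iotaOp_ι_mul, iotaOp_anticomm v x, eq_neg_of_add_eq_zero_left h, real_inner_comm v x]
  abel

/-- The grading involution of the exterior algebra, as a linear endomorphism. -/
def gradingInvolution (n : ℕ) : Module.End ℝ (ExteriorAlgebra ℝ (V n)) :=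
  (CliffordAlgebra.involute (Q := (0 : QuadraticForm ℝ (V n)))).toLinearMap

theorem gradingInvolution_mul_self (n : ℕ) :
    gradingInvolution n * gradingInvolution n = 1 :=
  LinearMap.ext CliffordAlgebra.involute_involute

theorem gradingInvolution_ι_mul {n : ℕ} (v : V n) (a : ExteriorAlgebra ℝ (V n)) :
    gradingInvolution n (ExteriorAlgebra.ι ℝ v * a) =
      -(ExteriorAlgebra.ι ℝ v * gradingInvolution n a) := by
  have h : gradingInvolution n (ExteriorAlgebra.ι ℝ v) = -ExteriorAlgebra.ι ℝ v :=
    CliffordAlgebra.involute_ι (Q := (0 : QuadraticForm ℝ (V n))) v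
  rw [← neg_mul, ← h]
  exact map_mul (CliffordAlgebra.involute (Q := (0 : QuadraticForm ℝ (V n)))) _ _

theorem gradingInvolution_mul_eps {n : ℕ} (v : V n) :
    gradingInvolution n * eps v = -(eps v * gradingInvolution n) :=
  LinearMap.ext (gradingInvolution_ι_mul v)

theorem gradingInvolution_mul_iotaOp {n : ℕ} (v : V n) :
    gradingInvolution n * iotaOp v = -(iotaOp v * gradingInvolution n) := by
  refine LinearMap.ext fun a => ?_
  change gradingInvolution n (iotaOp v a) = -iotaOp v (gradingInvolution n a)
  induction a using CliffordAlgebra.left_induction with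
  | algebraMap r =>
    have h₁ : iotaOp v (algebraMap ℝ (ExteriorAlgebra ℝ (V n)) r) = 0 :=
      CliffordAlgebra.contractLeft_algebraMap _ _ _
    have h₂ : gradingInvolution n (algebraMap ℝ (ExteriorAlgebra ℝ (V n)) r) =
        algebraMap ℝ _ r :=
      AlgHom.commutes (CliffordAlgebra.involute (Q := (0 : QuadraticForm ℝ (V n)))) r
    erw [h₁, h₂, h₁]
    simp
  | add a b ha hb =>
    erw [map_add, map_add, map_add, map_add, ha, hb, neg_add]
  | ι_mul a w ha =>
    change gradingInvolution n (iotaOp v (ExteriorAlgebra.ι ℝ w * a)) =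
      -iotaOp v (gradingInvolution n (ExteriorAlgebra.ι ℝ w * a))
    rw [gradingInvolution_ι_mul, iotaOp_ι_mul, map_sub, map_neg, iotaOp_ι_mul,
      gradingInvolution_ι_mul, ha, map_smul]
    simp

theorem gradingInvolution_mul_cOp {n : ℕ} (v : V n) :
    gradingInvolution n * cOp v = -(cOp v * gradingInvolution n) := by
  rw [cOp, mul_sub, sub_mul, gradingInvolution_mul_eps, gradingInvolution_mul_iotaOp]
  abel

theorem gradingInvolution_mul_cHat {n : ℕ} (v : V n) :
    gradingInvolution n * cHat v = -(cHat v * gradingInvolution n) := by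
  rw [cHat, mul_add, add_mul, gradingInvolution_mul_eps, gradingInvolution_mul_iotaOp]
  abel

theorem mul_list_prod_of_anticomm {R : Type*} [Ring R] (a : R) (l : List R)
    (h : ∀ b ∈ l, a * b = -(b * a)) : a * l.prod = (-1) ^ l.length * (l.prod * a) := by
  induction l with
  | nil => simp
  | cons b l ih =>
    rw [List.forall_mem_cons] at h
    rw [List.prod_cons, ← mul_assoc, h.1, neg_mul, mul_assoc, ih h.2, List.length_cons, pow_succ]
    rcases neg_one_pow_eq_or R l.length with h' | h' <;> simp [h', mul_assoc]

theorem mul_list_prod_of_anticomm_of_even {R : Type*} [Ring R] (a : R) (l : List R)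
    (h : ∀ b ∈ l, a * b = -(b * a)) (hl : Even l.length) : a * l.prod = l.prod * a := by
  rw [mul_list_prod_of_anticomm a l h, hl.neg_one_pow, one_mul]

theorem mul_list_prod_of_anticomm_of_odd {R : Type*} [Ring R] (a : R) (l : List R)
    (h : ∀ b ∈ l, a * b = -(b * a)) (hl : Odd l.length) : a * l.prod = -(l.prod * a) := by
  rw [mul_list_prod_of_anticomm a l h, hl.neg_one_pow, neg_one_mul]

theorem mul_mul_eq_neg_of_comm_of_anticomm {R : Type*} [Ring R] {a b c : R}
    (hb : a * b = b * a) (hc : a * c = -(c * a)) : a * (b * c) = -(b * c * a) := by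
  rw [← mul_assoc, hb, mul_assoc, hc, mul_neg, mul_assoc]

/-- An endomorphism that anticommutes with an involution is traceless. -/
theorem trace_eq_zero_of_anticomm_involution {M : Type*} [AddCommGroup M] [Module ℝ M]
    {g T : Module.End ℝ M} (hg : g * g = 1) (h : g * T = -(T * g)) :
    LinearMap.trace ℝ M T = 0 := by
  have h₁ : LinearMap.trace ℝ M (g * T * g) = LinearMap.trace ℝ M T := by
    rw [LinearMap.trace_mul_comm, ← mul_assoc, hg, one_mul]
  rw [h, neg_mul, mul_assoc, hg, mul_one, map_neg] at h₁
  linarith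

/-- for any finite list `v₁, …, v_k` of vectors and any vector `x`,
`tr[c(v₁)∘⋯∘c(v_k)∘ĉ(x)] = 0`. -/
theorem trace_cOp_list_cHat (n : ℕ) (hn : 1 ≤ n) (l : List (V n)) (x : V n) :
    LinearMap.trace ℝ (ExteriorAlgebra ℝ (V n)) ((l.map cOp).prod * cHat x) = 0 := by
  rcases Nat.even_or_odd l.length with hl | hl
  · refine trace_eq_zero_of_anticomm_involution (gradingInvolution_mul_self n) ?_
    have h := mul_list_prod_of_anticomm_of_even (gradingInvolution n) (l.map cOp)
      (by simpa using fun v _ => gradingInvolution_mul_cOp v) (by simpa using hl)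
    exact mul_mul_eq_neg_of_comm_of_anticomm h (gradingInvolution_mul_cHat x)
  · have h := mul_list_prod_of_anticomm_of_odd (cHat x) (l.map cOp)
      (by simpa using fun v _ => by rw [cOp_mul_cHat, neg_neg]) (by simpa using hl)
    have htr := LinearMap.trace_mul_comm ℝ (l.map cOp).prod (cHat x)
    rw [h, map_neg] at htr
    linarith
end
end

section
/- For every k ∈ ℕ and every choice of indices γ₀, γ₁, …, γ_{2k+1} ∈ {1,…,n}, the monomial sphere integrals satisfy the recursion ∫_{S^{n−1}} ∏_{i=0}^{2k+1} x_{γ_i} dσ(x) = (1/(2k+n)) · ∑_{j=1}^{2k+1} δ_{γ₀ γ_j} · ∫_{S^{n−1}} ∏_{i≠0,j} x_{γ_i} dσ(x), where σ is the surface measure on the unit sphere S^{n−1}. -/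
noncomputable section

open scoped BigOperators
open MeasureTheory Metric

/-- The unit sphere `S^{n-1}` in Euclidean space `ℝⁿ`. -/
abbrev unitSphere (n : ℕ) := Metric.sphere (0 : EuclideanSpace ℝ (Fin n)) 1

/-- The `(n-1)`-dimensional spherical surface measure `σ` on the unit sphere
`S^{n-1} ⊆ ℝⁿ`, obtained from Lebesgue measure on `ℝⁿ`. -/
noncomputable def sphereMeasure (n : ℕ) : Measure (unitSphere n) :=
  (volume : Measure (EuclideanSpace ℝ (Fin n))).toSphere

/-- Integration of a positively homogeneous function times a radial function in polar
coordinates. -/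
theorem integral_homogeneous_mul_norm {E : Type*} [NormedAddCommGroup E] [NormedSpace ℝ E]
    [MeasurableSpace E] [BorelSpace E] [FiniteDimensional ℝ E] [Nontrivial E] (μ : Measure E)
    [μ.IsAddHaarMeasure] {P : E → ℝ} {d : ℕ}
    (hP : ∀ r : ℝ, 0 < r → ∀ x, P (r • x) = r ^ d * P x) (f : ℝ → ℝ) :
    ∫ x, P x * f ‖x‖ ∂μ = (∫ x : sphere (0 : E) 1, P x ∂μ.toSphere) *
      ∫ r in Set.Ioi (0 : ℝ), r ^ (Module.finrank ℝ E - 1 + d) * f r :=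
  calc
    ∫ x, P x * f ‖x‖ ∂μ = ∫ x : ({(0)}ᶜ : Set E), P x * f ‖x.1‖ ∂(μ.comap (↑)) := by
      rw [integral_subtype_comap (measurableSet_singleton _).compl fun x ↦ P x * f ‖x‖,
        restrict_compl_singleton]
    _ = ∫ x, P x.1 * ((x.2 : ℝ) ^ d * f x.2)
          ∂μ.toSphere.prod (.volumeIoiPow (Module.finrank ℝ E - 1)) := by
      rw [← μ.measurePreserving_homeomorphUnitSphereProd.integral_comp
        (Homeomorph.measurableEmbedding _)]
      refine integral_congr_ae (.of_forall fun x ↦ ?_)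
      have hx : 0 < ‖(x : E)‖ := norm_pos_iff.2 x.2
      have h := hP ‖(x : E)‖ hx (‖(x : E)‖⁻¹ • (x : E))
      rw [smul_inv_smul₀ hx.ne'] at h
      simp only [homeomorphUnitSphereProd_apply_fst_coe, homeomorphUnitSphereProd_apply_snd_coe]
      rw [h]
      ring
    _ = (∫ x : sphere (0 : E) 1, P x ∂μ.toSphere) *
          ∫ r : Set.Ioi (0 : ℝ), (r : ℝ) ^ d * f r
            ∂.volumeIoiPow (Module.finrank ℝ E - 1) :=
      integral_prod_mul (fun x : sphere (0 : E) 1 ↦ P x)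
        (fun r : Set.Ioi (0 : ℝ) ↦ (r : ℝ) ^ d * f r)
    _ = _ := by
      congr 1
      simp only [Measure.volumeIoiPow, ENNReal.ofReal]
      rw [integral_withDensity_eq_integral_smul,
        integral_subtype_comap measurableSet_Ioi fun a ↦
          Real.toNNReal (a ^ (Module.finrank ℝ E - 1)) • (a ^ d * f a),
        setIntegral_congr_fun measurableSet_Ioi fun x hx ↦ ?_]
      · rw [NNReal.smul_def, Real.coe_toNNReal _ (pow_nonneg hx.out.le _), smul_eq_mul, pow_add,
          mul_assoc]
      · exact (measurable_subtype_coe.pow_const _).real_toNNReal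

theorem integral_pow_mul_exp_neg_sq (m : ℕ) :
    ∫ r in Set.Ioi (0 : ℝ), r ^ m * Real.exp (-r ^ 2) = 1 / 2 * Real.Gamma ((m + 1) / 2) := by
  have h := integral_rpow_mul_exp_neg_rpow (p := 2) (q := m) two_pos
    (neg_one_lt_zero.trans_le m.cast_nonneg)
  simpa only [Real.rpow_natCast, Real.rpow_two] using h

theorem integrable_norm_pow_mul_exp_neg_norm_sq {E : Type*} [NormedAddCommGroup E]
    [NormedSpace ℝ E] [MeasurableSpace E] [BorelSpace E] [FiniteDimensional ℝ E] [Nontrivial E]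
    (μ : Measure E) [μ.IsAddHaarMeasure] (d : ℕ) :
    Integrable (fun x ↦ ‖x‖ ^ d * Real.exp (-‖x‖ ^ 2)) μ := by
  rw [integrable_fun_norm_addHaar μ (f := fun r ↦ r ^ d * Real.exp (-r ^ 2))]
  have h := integrableOn_rpow_mul_exp_neg_mul_sq one_pos
    (s := (Module.finrank ℝ E - 1 + d : ℕ)) (neg_one_lt_zero.trans_le (Nat.cast_nonneg _))
  simpa only [Real.rpow_natCast, neg_one_mul, pow_add, mul_assoc, smul_eq_mul] using h

section EuclideanSpace

variable {n : ℕ} {ι : Type*}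

theorem abs_prod_coord_le (s : Finset ι) (γ : ι → Fin n) (x : EuclideanSpace ℝ (Fin n)) :
    |∏ i ∈ s, x (γ i)| ≤ ‖x‖ ^ s.card := by
  rw [Finset.abs_prod, ← Finset.prod_const]
  exact Finset.prod_le_prod (fun i _ ↦ abs_nonneg _) fun i _ ↦ PiLp.norm_apply_le x (γ i)

theorem integrable_prod_coord_mul_exp_neg_norm_sq [NeZero n] (s : Finset ι) (γ : ι → Fin n) :
    Integrable fun x : EuclideanSpace ℝ (Fin n) ↦
      (∏ i ∈ s, x (γ i)) * Real.exp (-‖x‖ ^ 2) := by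
  refine (integrable_norm_pow_mul_exp_neg_norm_sq volume s.card).mono'
    (by fun_prop) (.of_forall fun x ↦ ?_)
  rw [norm_mul, Real.norm_of_nonneg (Real.exp_pos _).le]
  gcongr
  exact abs_prod_coord_le s γ x

theorem integral_prod_coord_mul_exp_neg_norm_sq [NeZero n] (s : Finset ι) (γ : ι → Fin n) :
    ∫ x : EuclideanSpace ℝ (Fin n), (∏ i ∈ s, x (γ i)) * Real.exp (-‖x‖ ^ 2) =
      (∫ x : unitSphere n, ∏ i ∈ s, (x : EuclideanSpace ℝ (Fin n)) (γ i) ∂sphereMeasure n) *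
        (1 / 2 * Real.Gamma ((n + s.card) / 2)) := by
  have hn : 1 ≤ n := NeZero.one_le
  refine (integral_homogeneous_mul_norm volume
    (P := fun x : EuclideanSpace ℝ (Fin n) ↦ ∏ i ∈ s, x (γ i)) (d := s.card)
    (fun r _ x ↦ by simp [Finset.prod_mul_distrib]) (fun r ↦ Real.exp (-r ^ 2))).trans ?_
  rw [integral_pow_mul_exp_neg_sq, finrank_euclideanSpace_fin, sphereMeasure]
  push_cast [hn]
  ring_nf

theorem hasFDerivAt_exp_neg_norm_sq {E : Type*} [NormedAddCommGroup E] [InnerProductSpace ℝ E]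
    (x : E) : HasFDerivAt (fun x : E ↦ Real.exp (-‖x‖ ^ 2))
      (Real.exp (-‖x‖ ^ 2) • -(2 • innerSL ℝ x : E →L[ℝ] ℝ)) x :=
  (hasStrictFDerivAt_norm_sq x).hasFDerivAt.fun_neg.exp

/-- Gaussian integration by parts for monomials. -/
theorem two_mul_integral_coord_mul_prod_coord_mul_exp_neg_norm_sq [NeZero n] [DecidableEq ι]
    (s : Finset ι) (γ : ι → Fin n) (a : Fin n) :
    2 * ∫ x : EuclideanSpace ℝ (Fin n), (x a * ∏ i ∈ s, x (γ i)) * Real.exp (-‖x‖ ^ 2) =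
      ∑ j ∈ s, (if a = γ j then (1 : ℝ) else 0) *
        ∫ x : EuclideanSpace ℝ (Fin n), (∏ i ∈ s.erase j, x (γ i)) * Real.exp (-‖x‖ ^ 2) := by
  have hint_prod := integrable_prod_coord_mul_exp_neg_norm_sq s γ
  have hint_coord : Integrable fun x : EuclideanSpace ℝ (Fin n) ↦
      (x a * ∏ i ∈ s, x (γ i)) * Real.exp (-‖x‖ ^ 2) := by
    simpa [Finset.prod_insertNone] using
      integrable_prod_coord_mul_exp_neg_norm_sq s.insertNone (fun o ↦ o.elim a γ)
  have hint_erase (j : ι) : Integrable fun x : EuclideanSpace ℝ (Fin n) ↦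
      (if a = γ j then (1 : ℝ) else 0) *
        ((∏ i ∈ s.erase j, x (γ i)) * Real.exp (-‖x‖ ^ 2)) :=
    (integrable_prod_coord_mul_exp_neg_norm_sq (s.erase j) γ).const_mul _
  have hderiv (x : EuclideanSpace ℝ (Fin n)) :
      HasFDerivAt (fun x : EuclideanSpace ℝ (Fin n) ↦ ∏ i ∈ s, x (γ i))
        (∑ j ∈ s, (∏ i ∈ s.erase j, x (γ i)) • EuclideanSpace.proj (𝕜 := ℝ) (γ j)) x :=
    HasFDerivAt.finsetProd (g := fun i (x : EuclideanSpace ℝ (Fin n)) ↦ x (γ i))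
      fun i _ ↦ (EuclideanSpace.proj (𝕜 := ℝ) (γ i)).hasFDerivAt
  have hexp (x : EuclideanSpace ℝ (Fin n)) : (∏ i ∈ s, x (γ i)) *
      (Real.exp (-‖x‖ ^ 2) • -(2 • innerSL ℝ x : EuclideanSpace ℝ (Fin n) →L[ℝ] ℝ))
        (EuclideanSpace.single a 1) =
      -(2 * ((x a * ∏ i ∈ s, x (γ i)) * Real.exp (-‖x‖ ^ 2))) := by
    simp [EuclideanSpace.inner_single_right]
    ring
  have hprod (x : EuclideanSpace ℝ (Fin n)) :
      (∑ j ∈ s, (∏ i ∈ s.erase j, x (γ i)) • EuclideanSpace.proj (𝕜 := ℝ) (γ j))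
        (EuclideanSpace.single a 1) * Real.exp (-‖x‖ ^ 2) =
      ∑ j ∈ s, (if a = γ j then (1 : ℝ) else 0) *
        ((∏ i ∈ s.erase j, x (γ i)) * Real.exp (-‖x‖ ^ 2)) := by
    simp [Finset.sum_mul, eq_comm (a := a)]
  have hparts := integral_bilinear_hasFDerivAt_right_eq_neg_left_of_integrable
    (μ := (volume : Measure (EuclideanSpace ℝ (Fin n)))) (B := ContinuousLinearMap.mul ℝ ℝ)
    (v := EuclideanSpace.single a 1)
    (g' := fun x ↦ Real.exp (-‖x‖ ^ 2) • -(2 • innerSL ℝ x : EuclideanSpace ℝ (Fin n) →L[ℝ] ℝ))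
    (by simpa only [ContinuousLinearMap.mul_apply', hprod] using
      integrable_finsetSum s fun j _ ↦ hint_erase j)
    (by simpa only [ContinuousLinearMap.mul_apply', hexp] using (hint_coord.const_mul 2).fun_neg)
    hint_prod (fun x _ ↦ hderiv x) (fun x _ ↦ hasFDerivAt_exp_neg_norm_sq x)
  simp only [ContinuousLinearMap.mul_apply', hexp, hprod] at hparts
  rw [integral_neg, neg_inj, integral_const_mul,
    integral_finsetSum s fun j _ ↦ hint_erase j] at hparts
  simpa only [integral_const_mul] using hparts

theorem integral_sphere_coord_mul_prod_coord [NeZero n] [DecidableEq ι] (s : Finset ι)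
    (γ : ι → Fin n) (a : Fin n) {m : ℕ} (hs : s.card = m + 1) :
    ((m : ℝ) + n) * ∫ x : unitSphere n, (x : EuclideanSpace ℝ (Fin n)) a *
        ∏ i ∈ s, (x : EuclideanSpace ℝ (Fin n)) (γ i) ∂sphereMeasure n =
      ∑ j ∈ s, (if a = γ j then (1 : ℝ) else 0) *
        ∫ x : unitSphere n, ∏ i ∈ s.erase j, (x : EuclideanSpace ℝ (Fin n)) (γ i)
          ∂sphereMeasure n := by
  have hpos : 0 < ((n : ℝ) + m) / 2 := by
    have : (0 : ℝ) < n := Nat.cast_pos.2 (NeZero.pos n)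
    positivity
  have hcoord := integral_prod_coord_mul_exp_neg_norm_sq s.insertNone (fun o ↦ o.elim a γ)
  simp only [Finset.prod_insertNone, Option.elim_none, Option.elim_some,
    Finset.card_insertNone, hs] at hcoord
  have hGamma : Real.Gamma (((n : ℝ) + (m + 1 + 1 : ℕ)) / 2) =
      (n + m) / 2 * Real.Gamma ((n + m) / 2) := by
    rw [← Real.Gamma_add_one hpos.ne']
    push_cast
    ring_nf
  have hparts := two_mul_integral_coord_mul_prod_coord_mul_exp_neg_norm_sq s γ a
  rw [hcoord, hGamma] at hparts
  have herase : ∀ j ∈ s, (s.erase j).card = m := fun j hj ↦ by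
    rw [Finset.card_erase_of_mem hj, hs, Nat.add_sub_cancel]
  have hsum : ∀ j ∈ s, (if a = γ j then (1 : ℝ) else 0) *
      ∫ x : EuclideanSpace ℝ (Fin n), (∏ i ∈ s.erase j, x (γ i)) * Real.exp (-‖x‖ ^ 2) =
      ((if a = γ j then (1 : ℝ) else 0) *
        ∫ x : unitSphere n, ∏ i ∈ s.erase j, (x : EuclideanSpace ℝ (Fin n)) (γ i)
          ∂sphereMeasure n) * (1 / 2 * Real.Gamma ((n + m) / 2)) := fun j hj ↦ by
    rw [integral_prod_coord_mul_exp_neg_norm_sq, herase j hj, mul_assoc]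
  rw [Finset.sum_congr rfl hsum, ← Finset.sum_mul] at hparts
  have hne : 1 / 2 * Real.Gamma (((n : ℝ) + m) / 2) ≠ 0 :=
    mul_ne_zero (by norm_num) (Real.Gamma_pos_of_pos hpos).ne'
  refine mul_right_cancel₀ hne (Eq.trans ?_ hparts)
  ring

end EuclideanSpace

/-- the recursion for monomial integrals over the unit sphere:
`∫_{S^{n−1}} ∏_{i=0}^{2k+1} x_{γ_i} dσ(x)
  = (1/(2k+n)) ∑_{j=1}^{2k+1} δ_{γ₀ γ_j} ∫_{S^{n−1}} ∏_{i≠0,j} x_{γ_i} dσ(x)`. -/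
theorem sphere_integral_monomial_recursion (n : ℕ) (hn : 2 ≤ n) (k : ℕ)
    (γ : Fin (2 * k + 2) → Fin n) :
    ∫ x : unitSphere n,
        (∏ i : Fin (2 * k + 2), (x : EuclideanSpace ℝ (Fin n)) (γ i))
        ∂(sphereMeasure n)
      = (1 / (2 * (k : ℝ) + (n : ℝ))) *
          ∑ j ∈ Finset.univ.erase (0 : Fin (2 * k + 2)),
            (if γ 0 = γ j then (1 : ℝ) else 0) *
              ∫ x : unitSphere n,
                (∏ i ∈ (Finset.univ.erase (0 : Fin (2 * k + 2))).erase j,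
                  (x : EuclideanSpace ℝ (Fin n)) (γ i))
                ∂(sphereMeasure n) := by
  have : NeZero n := ⟨by omega⟩
  have hne : 2 * (k : ℝ) + n ≠ 0 := by positivity
  have h := integral_sphere_coord_mul_prod_coord (Finset.univ.erase (0 : Fin (2 * k + 2))) γ (γ 0)
    (m := 2 * k) (by simp)
  push_cast at h
  rw [← h, one_div, inv_mul_cancel_left₀ hne]
  refine integral_congr_ae (.of_forall fun x ↦ ?_)
  exact (Finset.mul_prod_erase Finset.univ (fun i ↦ (x : EuclideanSpace ℝ (Fin n)) (γ i))
    (Finset.mem_univ 0)).symm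
end
end
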